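/- arXiv:1407.1205 — 4 statements merged into one kernel-verified Lean document; each statement's English description precedes it below -/
import Mathlib

section
/- For every vector x : I × Fin Nφ → ℝ, writing x i : Fin Nφ → ℝ for the block k ↦ x (i,k), the quadratic form of the pressure-system block matrix A satisfies the edge-wise decomposition x ⬝ᵥ (A *ᵥ x) = Σ_{j ∈ J} (Q j (ℓ j) *ᵥ x (ℓ j) + Q j (r j) *ᵥ x (r j)) ⬝ᵥ ((M j)⁻¹ *ᵥ (Q j (ℓ j) *ᵥ x (ℓ j) + Q j (r j) *ᵥ x (r j))). (This is the central identity in the proof of Lemma 3: after inverting the double sum over elements and edges, the quadratic form of A is a sum over edges of the quadratic form of (M j)⁻¹ evaluated at the assembled edge vector Q_{ℓ(j),j} x_{ℓ(j)} + Q_{r(j),j} x_{r(j)}.) -/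
open Matrix BigOperators

/-- The quadratic form of `N` at an assembled vector `∑ i, Q i *ᵥ y i` is the double sum of the
bilinear forms given by the blocks `(Q i)ᵀ * N * Q i'`. -/
theorem dotProduct_mulVec_sum_mulVec {R I m n : Type*} [CommSemiring R] [Fintype I] [Fintype m]
    [Fintype n] (N : Matrix m m R) (Q : I → Matrix m n R) (y : I → n → R) :
    (∑ i, Q i *ᵥ y i) ⬝ᵥ (N *ᵥ ∑ i, Q i *ᵥ y i) =
      ∑ i, ∑ i', y i ⬝ᵥ (((Q i)ᵀ * N * Q i') *ᵥ y i') := by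
  simp only [mulVec_sum, sum_dotProduct, dotProduct_sum]
  rw [Finset.sum_comm]
  refine Finset.sum_congr rfl fun i _ => Finset.sum_congr rfl fun i' _ => ?_
  rw [← mulVec_mulVec, ← mulVec_mulVec, dotProduct_mulVec (y i), vecMul_transpose]

/-- The quadratic form of a matrix indexed by a product, written blockwise. -/
theorem dotProduct_mulVec_prod {R I n : Type*} [CommSemiring R] [Fintype I] [Fintype n]
    (A : Matrix (I × n) (I × n) R) (x : I × n → R) :
    x ⬝ᵥ (A *ᵥ x) = ∑ i, ∑ i', (fun k => x (i, k)) ⬝ᵥ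
      ((Matrix.of fun k k' => A (i, k) (i', k')) *ᵥ fun k => x (i', k)) := by
  simp only [dotProduct, mulVec, Fintype.sum_prod_type, Matrix.of_apply, Finset.mul_sum]
  exact Finset.sum_congr rfl fun i _ => Finset.sum_comm

/-- The central identity in the proof of Lemma 3: the quadratic form of the
pressure-system block matrix `A` decomposes edge-wise as a sum over edges `j`
of the quadratic form of `(M j)⁻¹` evaluated at the assembled edge vector
`Q j (ℓ j) *ᵥ x (ℓ j) + Q j (r j) *ᵥ x (r j)`. -/
theorem stmt_2 (Nφ Nψ : ℕ) (hNφ : 1 ≤ Nφ)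
    (I J : Type) [Fintype I] [Nonempty I] [DecidableEq I] [Fintype J]
    (ℓ r : J → I) (hlr : ∀ j, ℓ j ≠ r j)
    (M : J → Matrix (Fin Nψ) (Fin Nψ) ℝ)
    (Q : J → I → Matrix (Fin Nψ) (Fin Nφ) ℝ)
    (hQ : ∀ j i, i ≠ ℓ j → i ≠ r j → Q j i = 0)
    (A : Matrix (I × Fin Nφ) (I × Fin Nφ) ℝ)
    (hA : ∀ i k i' k', A (i, k) (i', k') = ∑ j, ((Q j i)ᵀ * (M j)⁻¹ * (Q j i')) k k')
    (x : I × Fin Nφ → ℝ) :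
    x ⬝ᵥ (A *ᵥ x) =
      ∑ j, (Q j (ℓ j) *ᵥ (fun k => x (ℓ j, k)) + Q j (r j) *ᵥ (fun k => x (r j, k))) ⬝ᵥ
        ((M j)⁻¹ *ᵥ (Q j (ℓ j) *ᵥ (fun k => x (ℓ j, k)) + Q j (r j) *ᵥ (fun k => x (r j, k)))) := by
  have edge (j : J) : Q j (ℓ j) *ᵥ (fun k => x (ℓ j, k)) + Q j (r j) *ᵥ (fun k => x (r j, k)) =
      ∑ i, Q j i *ᵥ (fun k => x (i, k)) := by
    symm
    refine Fintype.sum_eq_add (ℓ j) (r j) (hlr j) fun i hi => ?_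
    rw [hQ j i hi.1 hi.2, zero_mulVec]
  have block (i i' : I) : (Matrix.of fun k k' => A (i, k) (i', k')) =
      ∑ j, (Q j i)ᵀ * (M j)⁻¹ * Q j i' := by
    ext k k'
    rw [Matrix.of_apply, hA, Matrix.sum_apply]
  simp only [edge, dotProduct_mulVec_sum_mulVec, dotProduct_mulVec_prod, block, sum_mulVec,
    dotProduct_sum]
  conv_rhs => rw [Finset.sum_comm]
  exact Finset.sum_congr rfl fun i _ => Finset.sum_comm
end

section
/- Suppose that for every j ∈ J the matrix M j is symmetric and positive definite. Then the pressure-system block matrix A is positive semidefinite: A is symmetric and x ⬝ᵥ (A *ᵥ x) ≥ 0 for every x : I × Fin Nφ → ℝ. (Lemma 3 of the paper: the system matrix of the discrete pressure Poisson equation arising from the staggered semi-implicit DG scheme, without boundary conditions, is positive semidefinite.) -/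
open Matrix BigOperators

/-- Lemma 3 of the paper: if each local mass matrix `M j` is symmetric and
positive definite, then the pressure-system block matrix `A` is positive
semidefinite, i.e. `A` is symmetric and `x ⬝ᵥ (A *ᵥ x) ≥ 0` for every `x`. -/
theorem stmt_3 (Nφ Nψ : ℕ) (hNφ : 1 ≤ Nφ)
    (I J : Type) [Fintype I] [Nonempty I] [DecidableEq I] [Fintype J]
    (ℓ r : J → I) (hlr : ∀ j, ℓ j ≠ r j)
    (M : J → Matrix (Fin Nψ) (Fin Nψ) ℝ)
    (Q : J → I → Matrix (Fin Nψ) (Fin Nφ) ℝ)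
    (hQ : ∀ j i, i ≠ ℓ j → i ≠ r j → Q j i = 0)
    (A : Matrix (I × Fin Nφ) (I × Fin Nφ) ℝ)
    (hA : ∀ i k i' k', A (i, k) (i', k') = ∑ j, ((Q j i)ᵀ * (M j)⁻¹ * (Q j i')) k k')
    (hMsym : ∀ j, (M j)ᵀ = M j)
    (hMpos : ∀ j, ∀ y : Fin Nψ → ℝ, y ≠ 0 → 0 < y ⬝ᵥ (M j *ᵥ y)) :
    Aᵀ = A ∧ ∀ x : I × Fin Nφ → ℝ, 0 ≤ x ⬝ᵥ (A *ᵥ x) := by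
  have hMpd : ∀ j, (M j).PosDef := fun j =>
    Matrix.PosDef.of_dotProduct_mulVec_pos
      (by rw [Matrix.IsHermitian, conjTranspose_eq_transpose_of_trivial, hMsym j])
      fun y hy => by simpa using hMpos j y hy
  let B : J → Matrix (Fin Nψ) (I × Fin Nφ) ℝ := fun j => Matrix.of fun a p => Q j p.1 a p.2
  have hAB : A = ∑ j, (B j)ᴴ * (M j)⁻¹ * B j := by
    ext ⟨i, k⟩ ⟨i', k'⟩
    simp [hA, B, Matrix.sum_apply, Matrix.mul_apply]
  have hpsd : A.PosSemidef := by
    rw [hAB]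
    exact Matrix.posSemidef_sum _ fun j _ =>
      (hMpd j).inv.posSemidef.conjTranspose_mul_mul_same (B j)
  refine ⟨?_, fun x => by simpa using hpsd.dotProduct_mulVec_nonneg x⟩
  simpa [conjTranspose_eq_transpose_of_trivial] using hpsd.isHermitian.eq
end

section
/- Suppose that for every edge j ∈ J the discrete gradient of a constant pressure vanishes, i.e. Q j (ℓ j) *ᵥ 𝟙 + Q j (r j) *ᵥ 𝟙 = 0, where 𝟙 : Fin Nφ → ℝ is the all-ones vector (the coefficient vector of the constant function 1). Then the constant block vector x₀ : I × Fin Nφ → ℝ defined by x₀ (i,k) = 1 is a nonzero element of the kernel of A, i.e. A *ᵥ x₀ = 0 and x₀ ≠ 0; in particular det A = 0. (Lemma 1 of the paper: without any boundary conditions, the pressure system of the staggered semi-implicit DG scheme is singular, because constant pressures lie in its kernel.) -/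
open Matrix BigOperators

/-- Lemma 1 of the paper: if the discrete gradient of a constant pressure
vanishes on every edge, then the constant block vector `x₀ ≡ 1` is a nonzero
element of the kernel of the pressure-system matrix `A`; in particular
`det A = 0`, i.e. the system without boundary conditions is singular. -/
theorem stmt_4 (Nφ Nψ : ℕ) (hNφ : 1 ≤ Nφ)
    (I J : Type) [Fintype I] [Nonempty I] [DecidableEq I] [Fintype J]
    (ℓ r : J → I) (hlr : ∀ j, ℓ j ≠ r j)
    (M : J → Matrix (Fin Nψ) (Fin Nψ) ℝ)
    (Q : J → I → Matrix (Fin Nψ) (Fin Nφ) ℝ)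
    (hQ : ∀ j i, i ≠ ℓ j → i ≠ r j → Q j i = 0)
    (A : Matrix (I × Fin Nφ) (I × Fin Nφ) ℝ)
    (hA : ∀ i k i' k', A (i, k) (i', k') = ∑ j, ((Q j i)ᵀ * (M j)⁻¹ * (Q j i')) k k')
    (hgrad : ∀ j, Q j (ℓ j) *ᵥ (fun _ => (1 : ℝ)) + Q j (r j) *ᵥ (fun _ => (1 : ℝ)) = 0) :
    (A *ᵥ (fun _ => (1 : ℝ)) = 0 ∧ (fun _ : I × Fin Nφ => (1 : ℝ)) ≠ 0) ∧ A.det = 0 := by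
  have hsum : ∀ j, ∑ i, Q j i *ᵥ (fun _ => (1 : ℝ)) = 0 := by
    intro j
    rw [Fintype.sum_eq_add (ℓ j) (r j) (hlr j), hgrad j]
    rintro i ⟨hl, hr⟩
    rw [hQ j i hl hr, zero_mulVec]
  have hker : A *ᵥ (fun _ => (1 : ℝ)) = 0 := by
    ext ⟨i, k⟩
    calc (A *ᵥ fun _ => (1 : ℝ)) (i, k)
        = ∑ i', ∑ k', ∑ j, ((Q j i)ᵀ * (M j)⁻¹ * Q j i') k k' := by
          simp only [mulVec, dotProduct, mul_one, Fintype.sum_prod_type, hA]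
      _ = ∑ j, ∑ i', ∑ k', ((Q j i)ᵀ * (M j)⁻¹ * Q j i') k k' := by
          rw [Finset.sum_comm]
          simp_rw [Finset.sum_comm (s := (Finset.univ : Finset I))]
          rw [Finset.sum_comm]
      _ = ∑ j, (((Q j i)ᵀ * (M j)⁻¹) *ᵥ ∑ i', Q j i' *ᵥ fun _ => (1 : ℝ)) k := by
          refine Finset.sum_congr rfl fun j _ => ?_
          rw [mulVec_sum, Finset.sum_apply]
          refine Finset.sum_congr rfl fun i' _ => ?_
          rw [mulVec_mulVec]
          simp [mulVec, dotProduct]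
      _ = 0 := by simp [hsum]
  have hne : (fun _ : I × Fin Nφ => (1 : ℝ)) ≠ 0 := fun h =>
    one_ne_zero (congrFun h (Classical.arbitrary I, ⟨0, hNφ⟩))
  exact ⟨⟨hker, hne⟩, exists_mulVec_eq_zero_iff.mp ⟨_, hne, hker⟩⟩
end

section
/- Suppose that for every j ∈ J the matrix M j is symmetric and positive definite, and suppose moreover that the assembled edge maps have jointly trivial kernel: for every x : I × Fin Nφ → ℝ with x ≠ 0 there exists j ∈ J such that Q j (ℓ j) *ᵥ x (ℓ j) + Q j (r j) *ᵥ x (r j) ≠ 0, where x i denotes the block k ↦ x (i,k). Then the pressure-system block matrix A is positive definite: A is symmetric and x ⬝ᵥ (A *ᵥ x) > 0 for every x ≠ 0. (This is the paper's claim that, once the pressure is specified on at least part of the boundary—so that the only discrete pressure field whose assembled edge gradients all vanish is zero—the complete system matrix is positive definite.) -/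
open Matrix BigOperators

namespace Matrix

/-- The matrices `Q i` placed side by side in a single block row. -/
def blockRow {I m n R : Type*} (Q : I → Matrix m n R) : Matrix m (I × n) R :=
  of fun p q => Q q.1 p q.2

theorem blockRow_mulVec {I m n R : Type*} [Fintype I] [Fintype n]
    [NonUnitalNonAssocSemiring R] (Q : I → Matrix m n R) (x : I × n → R) :
    blockRow Q *ᵥ x = ∑ i, Q i *ᵥ fun k => x (i, k) := by
  ext p
  simp [blockRow, mulVec, dotProduct, Fintype.sum_prod_type, Finset.sum_apply]

theorem dotProduct_transpose_mul_mul_mulVec {m n R : Type*} [Fintype m] [Fintype n]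
    [CommSemiring R] (B : Matrix m n R) (N : Matrix m m R) (x : n → R) :
    x ⬝ᵥ ((Bᵀ * N * B) *ᵥ x) = (B *ᵥ x) ⬝ᵥ (N *ᵥ (B *ᵥ x)) := by
  rw [← mulVec_mulVec, ← mulVec_mulVec, dotProduct_mulVec, vecMul_transpose]

end Matrix

/-- If each local mass matrix `M j` is symmetric and positive definite, and the
assembled edge maps have jointly trivial kernel (as happens once the pressure is
specified on at least part of the boundary), then the pressure-system block
matrix `A` is symmetric and positive definite. -/
theorem stmt_5 (Nφ Nψ : ℕ) (hNφ : 1 ≤ Nφ)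
    (I J : Type) [Fintype I] [Nonempty I] [DecidableEq I] [Fintype J]
    (ℓ r : J → I) (hlr : ∀ j, ℓ j ≠ r j)
    (M : J → Matrix (Fin Nψ) (Fin Nψ) ℝ)
    (Q : J → I → Matrix (Fin Nψ) (Fin Nφ) ℝ)
    (hQ : ∀ j i, i ≠ ℓ j → i ≠ r j → Q j i = 0)
    (A : Matrix (I × Fin Nφ) (I × Fin Nφ) ℝ)
    (hA : ∀ i k i' k', A (i, k) (i', k') = ∑ j, ((Q j i)ᵀ * (M j)⁻¹ * (Q j i')) k k')
    (hMsym : ∀ j, (M j)ᵀ = M j)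
    (hMpos : ∀ j, ∀ y : Fin Nψ → ℝ, y ≠ 0 → 0 < y ⬝ᵥ (M j *ᵥ y))
    (hker : ∀ x : I × Fin Nφ → ℝ, x ≠ 0 →
      ∃ j, Q j (ℓ j) *ᵥ (fun k => x (ℓ j, k)) + Q j (r j) *ᵥ (fun k => x (r j, k)) ≠ 0) :
    Aᵀ = A ∧ ∀ x : I × Fin Nφ → ℝ, x ≠ 0 → 0 < x ⬝ᵥ (A *ᵥ x) := by
  have hinv (j : J) : (M j)⁻¹.PosDef :=
    (PosDef.of_dotProduct_mulVec_pos (by simpa [IsHermitian] using hMsym j)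
      fun {y} hy => by simpa using hMpos j y hy).inv
  have hA_sum : A = ∑ j, (blockRow (Q j))ᵀ * (M j)⁻¹ * blockRow (Q j) := by
    ext ⟨i, k⟩ ⟨i', k'⟩
    rw [hA, Matrix.sum_apply]
    rfl
  have hrow (j : J) (x : I × Fin Nφ → ℝ) : blockRow (Q j) *ᵥ x =
      Q j (ℓ j) *ᵥ (fun k => x (ℓ j, k)) + Q j (r j) *ᵥ (fun k => x (r j, k)) := by
    rw [blockRow_mulVec]
    exact Fintype.sum_eq_add _ _ (hlr j) fun i hi => by rw [hQ j i hi.1 hi.2, zero_mulVec]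
  constructor
  · simp only [hA_sum, transpose_sum, transpose_mul, transpose_transpose, transpose_nonsing_inv,
      hMsym, Matrix.mul_assoc]
  · intro x hx
    simp only [hA_sum, sum_mulVec, dotProduct_sum, dotProduct_transpose_mul_mul_mulVec]
    obtain ⟨j, hj⟩ := hker x hx
    refine Finset.sum_pos' (fun j _ => ?_) ⟨j, Finset.mem_univ j, ?_⟩
    · simpa using (hinv j).posSemidef.dotProduct_mulVec_nonneg (blockRow (Q j) *ᵥ x)
    · simpa using (hinv j).dotProduct_mulVec_pos ((hrow j x).trans_ne hj)
end
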